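/- For each d ∈ ℤ_+, each t ∈ (0, 2^{-8}) and each ξ ∈ 𝕋^d one has H_t(0) · exp(-|ξ|²/(4t)) ≤ H_t(ξ) ≤ H_t(0) · exp(-|ξ|²/(40t)). -/

import Mathlib

open scoped ENNReal Real BigOperators
open Real

/-- The one-dimensional Theta function `θ_t(ζ) = Σ_{k∈ℤ} exp(-π(k-ζ)²t)`. -/
noncomputable def theta (t ζ : ℝ) : ℝ :=
  ∑' k : ℤ, Real.exp (-π * ((k : ℝ) - ζ) ^ 2 * t)

/-- The d-dimensional Theta function `Θ_t(ξ) = Π_j θ_t(ξ_j)`. -/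
noncomputable def bigTheta (d : ℕ) (t : ℝ) (ξ : Fin d → ℝ) : ℝ :=
  ∏ j, theta t (ξ j)

/-- The discrete normalized Gaussian kernel `g_t(n) = Θ_{1/t}(0)⁻¹ exp(-π|n|²/t)`. -/
noncomputable def gauss (d : ℕ) (t : ℝ) (n : Fin d → ℤ) : ℝ :=
  (bigTheta d (1 / t) 0)⁻¹ * Real.exp (-π * (∑ j, ((n j : ℝ)) ^ 2) / t)

/-- The convolution operator `G_t f(x) = Σ_n g_t(n) f(x-n)` on ℤ^d. -/
noncomputable def gConv (d : ℕ) (t : ℝ) (f : (Fin d → ℤ) → ℂ) (x : Fin d → ℤ) : ℂ :=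
  ∑' n : Fin d → ℤ, (gauss d t n : ℂ) * f (x - n)

/-- The ℓ^p norm (valued in ℝ≥0∞) of an ℝ≥0∞-valued function on ℤ^d. -/
noncomputable def lpNorm (d : ℕ) (p : ℝ) (F : (Fin d → ℤ) → ℝ≥0∞) : ℝ≥0∞ :=
  (∑' x : Fin d → ℤ, F x ^ p) ^ (1 / p)

/-- The heat kernel on the torus 𝕋^d (identified with [-1/2,1/2)^d):
`H_t(ξ) = (4πt)^{-d/2} Σ_{n∈ℤ^d} exp(-|n-ξ|²/(4t))`. -/
noncomputable def heat (d : ℕ) (t : ℝ) (ξ : Fin d → ℝ) : ℝ :=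
  (4 * π * t) ^ (-(d : ℝ) / 2) *
    ∑' n : Fin d → ℤ, Real.exp (-(∑ j, ((n j : ℝ) - ξ j) ^ 2) / (4 * t))

lemma hk_geom : HasSum (fun k : ℤ => ((1:ℝ)/4) ^ k.natAbs) (5/3) := by
  have h1 : HasSum (fun n : ℕ => ((1:ℝ)/4) ^ n) (4/3) := by
    have := hasSum_geometric_of_lt_one (r := (1:ℝ)/4) (by norm_num) (by norm_num)
    convert this using 1; norm_num
  have h2 : HasSum (fun n : ℕ => ((1:ℝ)/4) ^ (n+1)) (1/3) := by
    have := h1.mul_left (1/4)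
    rw [show (1:ℝ)/4 * (4/3) = 1/3 by norm_num] at this
    simpa only [pow_succ'] using this
  have := HasSum.of_nat_of_neg_add_one (f := fun k : ℤ => ((1:ℝ)/4) ^ k.natAbs) (m := 4/3) (m' := 1/3)
    (by simpa using h1) (by
      convert h2 using 2 with n
      rw [show (-((n:ℤ)+1)).natAbs = n + 1 by omega])
  convert this using 1; norm_num

lemma hk_exp_two : Real.exp (-2) ≤ 1/4 := by
  rw [Real.exp_neg, one_div]
  apply inv_anti₀ (by norm_num)
  have h := Real.add_one_le_exp (1:ℝ)
  have : Real.exp 2 = Real.exp 1 * Real.exp 1 := by rw [← Real.exp_add]; norm_num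
  rw [this]; nlinarith

lemma hk_exp_le (c : ℝ) (n : ℕ) (h : c ≤ -2 * n) : Real.exp c ≤ (1/4) ^ n := by
  calc Real.exp c ≤ Real.exp (n * (-2)) := Real.exp_le_exp.2 (by linarith)
    _ = Real.exp (-2) ^ n := Real.exp_nat_mul _ _
    _ ≤ _ := pow_le_pow_left₀ (Real.exp_pos _).le hk_exp_two n

lemma hk_abs (k : ℤ) : ((k.natAbs : ℕ) : ℝ) = |(k:ℝ)| := by
  rw [Nat.cast_natAbs]; simp

lemma hk_sq (k : ℤ) : ((k.natAbs : ℕ) : ℝ)^2 = (k:ℝ)^2 := by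
  rw [hk_abs, sq_abs]

lemma hk_mul_le (k : ℤ) (x : ℝ) : (k:ℝ) * x ≤ (k.natAbs : ℝ) * |x| := by
  rw [hk_abs, ← abs_mul]; exact le_abs_self _

lemma hk_nat_sq (m : ℕ) : (m:ℝ) ≤ (m:ℝ)^2 := by
  exact_mod_cast Nat.le_self_pow (by norm_num) m

lemma hk_summable (a x : ℝ) (ha : 64 ≤ a) (hx : |x| ≤ 1/2) :
    Summable (fun k : ℤ => Real.exp (-a * ((k:ℝ) - x)^2)) := by
  refine Summable.of_nonneg_of_le (fun _ => (Real.exp_pos _).le) (fun k => ?_)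
    (hk_geom.summable.mul_left (Real.exp a))
  have key : Real.exp (-a * ((k:ℝ) - x)^2) = Real.exp a * Real.exp (-a * ((k:ℝ) - x)^2 - a) := by
    rw [← Real.exp_add]; ring_nf
  rw [key]
  refine mul_le_mul_of_nonneg_left (hk_exp_le _ _ ?_) (Real.exp_pos _).le
  have h1 := hk_sq k
  have h2 := hk_mul_le k x
  have h3 : (0:ℝ) ≤ (k.natAbs:ℝ) := Nat.cast_nonneg _
  have h4 : (k.natAbs : ℝ) * |x| ≤ k.natAbs * (1/2) := mul_le_mul_of_nonneg_left hx h3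
  have h5 : (k.natAbs:ℝ) - 1 ≤ ((k:ℝ) - x)^2 := by nlinarith [sq_nonneg ((k.natAbs:ℝ) - 1), sq_nonneg x]
  nlinarith

lemma hk_symm (a x : ℝ) : (∑' k : ℤ, Real.exp (-a * ((k:ℝ) + x)^2)) =
    ∑' k : ℤ, Real.exp (-a * ((k:ℝ) - x)^2) := by
  rw [← (Equiv.neg ℤ).tsum_eq (fun k : ℤ => Real.exp (-a * ((k:ℝ) - x)^2))]
  congr 1; funext k; congr 1
  simp only [Equiv.neg_apply, Int.cast_neg]; ring

lemma hk_summable' (a x : ℝ) (ha : 64 ≤ a) (hx : |x| ≤ 1/2) :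
    Summable (fun k : ℤ => Real.exp (-a * ((k:ℝ) + x)^2)) := by
  simpa using hk_summable a (-x) ha (by simpa using hx)

lemma hk_double (a x : ℝ) (ha : 64 ≤ a) (hx : |x| ≤ 1/2) :
    HasSum (fun k : ℤ => (Real.exp (-a * ((k:ℝ) - x)^2) + Real.exp (-a * ((k:ℝ) + x)^2)))
    (2 * ∑' k : ℤ, Real.exp (-a * ((k:ℝ) - x)^2)) := by
  have := (hk_summable a x ha hx).hasSum.add (hk_summable' a x ha hx).hasSum
  rw [hk_symm] at this
  convert this using 1; ring

lemma hk_term (a x : ℝ) (k : ℤ) :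
    Real.exp (-a * ((k:ℝ) - x)^2) + Real.exp (-a * ((k:ℝ) + x)^2) =
    Real.exp (-a * x^2) * (Real.exp (-a * (k:ℝ)^2) *
      (Real.exp (2*a*k*x) + Real.exp (-(2*a*k*x)))) := by
  simp only [mul_add, ← Real.exp_add]
  ring_nf

lemma hk_summable0 (a : ℝ) (ha : 64 ≤ a) :
    Summable (fun k : ℤ => Real.exp (-a * (k:ℝ)^2)) := by
  simpa using hk_summable a 0 ha (by simp)

lemma hk_lower (a x : ℝ) (ha : 64 ≤ a) (hx : |x| ≤ 1/2) :
    (∑' k : ℤ, Real.exp (-a * (k:ℝ)^2)) * Real.exp (-a * x^2) ≤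
    ∑' k : ℤ, Real.exp (-a * ((k:ℝ) - x)^2) := by
  have h0 := (hk_summable0 a ha).hasSum.mul_left (2 * Real.exp (-a * x^2))
  have := hasSum_le (fun k => ?_) h0 (hk_double a x ha hx)
  · linarith
  · rw [hk_term]
    have h2 : 2 ≤ Real.exp (2*a*k*x) + Real.exp (-(2*a*k*x)) := by
      have := Real.add_one_le_exp (2*a*k*x)
      have := Real.add_one_le_exp (-(2*a*k*x))
      linarith
    calc _ = Real.exp (-a * x^2) * (Real.exp (-a * (k:ℝ)^2) * 2) := by ring
      _ ≤ _ := by gcongr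

lemma hk_one_le (a : ℝ) (ha : 64 ≤ a) : 1 ≤ ∑' k : ℤ, Real.exp (-a * (k:ℝ)^2) := by
  have := (hk_summable0 a ha).le_tsum 0 (fun _ _ => (Real.exp_pos _).le)
  simpa using this

lemma hk_upper_large (a x : ℝ) (ha : 64 ≤ a) (hx : |x| ≤ 1/2) (hx' : 1/4 ≤ |x|) :
    ∑' k : ℤ, Real.exp (-a * ((k:ℝ) - x)^2) ≤
    (∑' k : ℤ, Real.exp (-a * (k:ℝ)^2)) * Real.exp (-a * x^2 / 10) := by
  have h0 := hk_geom.mul_left (Real.exp (-a * x^2 / 10) * (1/4))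
  have h1 := hasSum_le (fun k => ?_) (hk_summable a x ha hx).hasSum h0
  · have := hk_one_le a ha
    have := Real.exp_pos (-a * x^2 / 10)
    nlinarith
  · have e1 : Real.exp (-a * ((k:ℝ) - x)^2) =
        Real.exp (-a * x^2 / 10) * Real.exp (-a * (((k:ℝ) - x)^2 - x^2/10)) := by
      rw [← Real.exp_add]; ring_nf
    rw [e1, mul_assoc, ← pow_succ']
    refine mul_le_mul_of_nonneg_left (hk_exp_le _ _ ?_) (Real.exp_pos _).le
    have h1 := hk_sq k
    have h2 := hk_mul_le k x
    have hy := sq_abs x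
    push_cast
    generalize k.natAbs = m at *
    generalize |x| = y at *
    have h3 : ((m:ℝ) + 1)/32 ≤ ((k:ℝ) - x)^2 - x^2/10 := by
      have h4 : ((m:ℝ) - y)^2 ≤ ((k:ℝ) - x)^2 := by nlinarith
      rw [← hy]
      refine le_trans ?_ (sub_le_sub_right h4 _)
      rcases m with _ | _ | m
      · norm_num; nlinarith
      · norm_num; nlinarith
      · have : (0:ℝ) ≤ m := Nat.cast_nonneg _
        push_cast; nlinarith
    nlinarith [Nat.cast_nonneg (α := ℝ) m]

lemma hk_cosh (u : ℝ) : Real.exp u + Real.exp (-u) ≤ 2 + u^2 * Real.exp |u| := by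
  wlog hu : 0 ≤ u with H
  · have := H (-u) (by linarith)
    simp only [neg_neg, abs_neg, neg_sq] at this
    linarith
  rw [abs_of_nonneg hu]
  have h1 := Real.add_one_le_exp (-u)
  have h2 : Real.exp (-u) ≤ 1 := Real.exp_le_one_iff.2 (by linarith)
  have h3 : Real.exp u * Real.exp (-u) = 1 := by rw [← Real.exp_add]; simp
  have h4 : (1 - Real.exp (-u))^2 ≤ u^2 := pow_le_pow_left₀ (by linarith) (by linarith) 2
  have h5 := mul_le_mul_of_nonneg_left h4 (Real.exp_pos u).le
  have h6 : Real.exp u * (1 - Real.exp (-u))^2 = Real.exp u + Real.exp (-u) - 2 := by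
    linear_combination (-2 + Real.exp (-u)) * h3
  linarith

lemma hk_small_term (a x : ℝ) (ha : 64 ≤ a) (hx : |x| ≤ 1/4) (k : ℤ) :
    Real.exp (-a * (k:ℝ)^2) * (Real.exp (2*a*k*x) + Real.exp (-(2*a*k*x))) ≤
    2 * Real.exp (-a * (k:ℝ)^2) + 32 * x^2 * (1/4)^k.natAbs := by
  have hc := mul_le_mul_of_nonneg_left (hk_cosh (2*a*k*x)) (Real.exp_pos (-a * (k:ℝ)^2)).le
  have e : |2*a*k*x| = 2*a*(k.natAbs * |x|) := by
    rw [abs_mul, abs_mul, hk_abs, abs_of_nonneg (by linarith : 0 ≤ 2*a)]; ring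
  have hm : (0:ℝ) ≤ (k.natAbs:ℝ) := Nat.cast_nonneg _
  have h4 : (k.natAbs : ℝ) * |x| ≤ k.natAbs * (1/4) := mul_le_mul_of_nonneg_left hx hm
  have hs := hk_nat_sq k.natAbs
  have hsq := hk_sq k
  rw [e] at hc
  suffices hh : (4*a^2*(k:ℝ)^2) * (Real.exp (-a * (k:ℝ)^2) * Real.exp (2*a*(k.natAbs * |x|)))
      ≤ 32 * (1/4)^k.natAbs by
    have := mul_le_mul_of_nonneg_left hh (sq_nonneg x)
    nlinarith
  rw [← Real.exp_add, ← hsq]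
  rw [← hsq] at hc
  generalize k.natAbs = m at *
  rcases Nat.eq_zero_or_pos m with rfl | hpos
  · simp
  have hm1 : (1:ℝ) ≤ m := by exact_mod_cast hpos
  have h5 : -a * (m:ℝ)^2 + 2*a*(m * |x|) ≤ -(a*m/4) + -(a*m/4) := by nlinarith
  have h6 : 0 ≤ a*m/4 := by positivity
  have h7 := Real.quadratic_le_exp_of_nonneg h6
  have h8 : (a*m/4)^2 * Real.exp (-(a*m/4)) ≤ 2 := by
    have h3 : Real.exp (a*m/4) * Real.exp (-(a*m/4)) = 1 := by rw [← Real.exp_add]; simp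
    have h9 : (a*m/4)^2 ≤ 2 * Real.exp (a*m/4) := by nlinarith
    have := mul_le_mul_of_nonneg_right h9 (Real.exp_pos (-(a*m/4))).le
    linarith
  have h9 : Real.exp (-(a*m/4)) ≤ (1/4)^(m+2) := by
    apply hk_exp_le; push_cast; nlinarith
  calc _ ≤ (4*a^2*(m:ℝ)^2) * (Real.exp (-(a*m/4)) * Real.exp (-(a*m/4))) := by
        rw [← Real.exp_add]
        exact mul_le_mul_of_nonneg_left (Real.exp_le_exp.2 h5) (by positivity)
    _ = 64 * ((a*m/4)^2 * Real.exp (-(a*m/4))) * Real.exp (-(a*m/4)) := by ring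
    _ ≤ 64 * 2 * (1/4)^(m+2) := by gcongr
    _ ≤ _ := by
        have : (0:ℝ) ≤ (1/4)^m := by positivity
        rw [pow_add]; linarith

lemma hk_upper_small (a x : ℝ) (ha : 64 ≤ a) (hx : |x| ≤ 1/4) :
    ∑' k : ℤ, Real.exp (-a * ((k:ℝ) - x)^2) ≤
    (∑' k : ℤ, Real.exp (-a * (k:ℝ)^2)) * Real.exp (-a * x^2 / 10) := by
  have h0 := (((hk_summable0 a ha).hasSum.mul_left 2).add
    (hk_geom.mul_left (32 * x^2))).mul_left (Real.exp (-a * x^2))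
  have h1 := hasSum_le (fun k => ?_) (hk_double a x ha (by linarith)) h0
  · have hS := hk_one_le a ha
    set S := ∑' k : ℤ, Real.exp (-a * (k:ℝ)^2)
    have e : Real.exp (-a * x^2 / 10) = Real.exp (-a * x^2) * Real.exp (9/10 * a * x^2) := by
      rw [← Real.exp_add]; ring_nf
    have h2 := Real.add_one_le_exp (9/10 * a * x^2)
    have hx2 := sq_nonneg x
    have h3 : 2 * S + 32 * x^2 * (5/3) ≤ 2 * (S * Real.exp (9/10 * a * x^2)) := by
      have h4 : S * (9/10*a*x^2+1) ≤ S * Real.exp (9/10 * a * x^2) :=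
        mul_le_mul_of_nonneg_left h2 (by linarith)
      have h5 : 64 * x^2 ≤ a * x^2 := mul_le_mul_of_nonneg_right ha hx2
      have h6 : 1 * (a*x^2) ≤ S * (a * x^2) := mul_le_mul_of_nonneg_right hS (by nlinarith)
      nlinarith
    have h7 := mul_le_mul_of_nonneg_left h3 (Real.exp_pos (-a * x^2)).le
    rw [e]; nlinarith
  · rw [hk_term]
    exact mul_le_mul_of_nonneg_left (hk_small_term a x ha hx k) (Real.exp_pos _).le

lemma hk_prod (d : ℕ) (f : Fin d → ℤ → ℝ) (h0 : ∀ j k, 0 ≤ f j k) (hf : ∀ j, Summable (f j)) :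
    HasSum (fun n : Fin d → ℤ => ∏ j, f j (n j)) (∏ j, ∑' k, f j k) := by
  induction d with
  | zero => simp
  | succ d ih =>
    have h1 := ih (fun j => f j.succ) (fun j k => h0 _ _) (fun j => hf _)
    have h3 : ∀ n : Fin d → ℤ, 0 ≤ ∏ j, f j.succ (n j) :=
      fun n => Finset.prod_nonneg (fun j _ => h0 _ _)
    have h4 : Summable (fun p : ℤ × (Fin d → ℤ) => f 0 p.1 * ∏ j, f (Fin.succ j) (p.2 j)) :=
      Summable.mul_of_nonneg (g := fun n : Fin d → ℤ => ∏ j, f (Fin.succ j) (n j))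
        (hf 0) h1.summable (h0 0) h3
    have h2 := HasSum.mul (g := fun n : Fin d → ℤ => ∏ j, f (Fin.succ j) (n j))
      (hf 0).hasSum h1 h4
    rw [← (Fin.consEquiv (fun _ : Fin (d+1) => ℤ)).hasSum_iff, Fin.prod_univ_succ]
    have e : (fun n : Fin (d+1) → ℤ => ∏ j, f j (n j)) ∘ (Fin.consEquiv (fun _ : Fin (d+1) => ℤ))
        = fun p : ℤ × (Fin d → ℤ) => f 0 p.1 * ∏ j, f (Fin.succ j) (p.2 j) := by
      funext p
      simp [Fin.consEquiv, Fin.prod_univ_succ]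
    rw [e]
    exact h2

lemma hk_heat (d : ℕ) (t : ℝ) (ξ : Fin d → ℝ) (ha : 64 ≤ 1/(4*t))
    (hξ : ∀ j, |ξ j| ≤ 1/2) :
    heat d t ξ = (4 * π * t) ^ (-(d : ℝ) / 2) *
      ∏ j, ∑' k : ℤ, Real.exp (-(1/(4*t)) * ((k:ℝ) - ξ j)^2) := by
  rw [heat, ← (hk_prod d _ (fun j k => (Real.exp_pos _).le)
    (fun j => hk_summable _ (ξ j) ha (hξ j))).tsum_eq]
  congr 2; funext n
  rw [← Real.exp_sum, ← Finset.mul_sum]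
  congr 1; ring

/-- Small-time two-sided Gaussian bounds for the heat kernel on 𝕋^d: for `0 < t < 2^{-8}` and
`ξ ∈ 𝕋^d`, `H_t(0) exp(-|ξ|²/(4t)) ≤ H_t(ξ) ≤ H_t(0) exp(-|ξ|²/(40t))`. -/
theorem heat_kernel_small_time (d : ℕ) (hd : 0 < d) (t : ℝ) (ht : 0 < t)
    (ht' : t < (2 : ℝ) ^ (-8 : ℤ)) (ξ : Fin d → ℝ)
    (hξ : ∀ j, ξ j ∈ Set.Ico (-(1/2) : ℝ) (1/2)) :
    heat d t 0 * Real.exp (-(∑ j, ξ j ^ 2) / (4 * t)) ≤ heat d t ξ ∧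
      heat d t ξ ≤ heat d t 0 * Real.exp (-(∑ j, ξ j ^ 2) / (40 * t)) := by
  have ha : 64 ≤ 1/(4*t) := by
    rw [le_div_iff₀ (by positivity)]
    norm_num at ht'
    linarith
  have hx : ∀ j, |ξ j| ≤ 1/2 := fun j => abs_le.2 ⟨(hξ j).1, (hξ j).2.le⟩
  have hC : 0 ≤ (4 * π * t) ^ (-(d : ℝ) / 2) := by positivity
  have e4 : Real.exp (-(∑ j, ξ j ^ 2) / (4 * t)) = ∏ j, Real.exp (-(1/(4*t)) * ξ j ^ 2) := by
    rw [← Real.exp_sum, ← Finset.mul_sum]; congr 1; ring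
  have e40 : Real.exp (-(∑ j, ξ j ^ 2) / (40 * t)) = ∏ j, Real.exp (-(1/(4*t)) * ξ j ^ 2 / 10) := by
    rw [← Real.exp_sum, ← Finset.sum_div, ← Finset.mul_sum]; congr 1; field_simp; ring
  rw [hk_heat d t ξ ha hx, hk_heat d t 0 ha (by simp), e4, e40]
  generalize (4 * π * t) ^ (-(d : ℝ) / 2) = C at *
  rw [mul_assoc, mul_assoc,
    ← Finset.prod_mul_distrib, ← Finset.prod_mul_distrib]
  simp only [Pi.zero_apply, sub_zero]
  have hp : ∀ j, 0 ≤ ∑' k : ℤ, Real.exp (-(1/(4*t)) * ((k:ℝ) - ξ j)^2) :=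
    fun j => tsum_nonneg (fun _ => (Real.exp_pos _).le)
  have hp0 : 0 ≤ ∑' k : ℤ, Real.exp (-(1/(4*t)) * (k:ℝ)^2) :=
    tsum_nonneg (fun _ => (Real.exp_pos _).le)
  constructor
  · refine mul_le_mul_of_nonneg_left (Finset.prod_le_prod (fun j _ => ?_) (fun j _ => ?_)) hC
    · exact mul_nonneg hp0 (Real.exp_pos _).le
    · exact hk_lower _ _ ha (hx j)
  · refine mul_le_mul_of_nonneg_left (Finset.prod_le_prod (fun j _ => hp j) (fun j _ => ?_)) hC
    rcases le_total |ξ j| (1/4) with h | h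
    · exact hk_upper_small _ _ ha h
    · exact hk_upper_large _ _ ha (hx j) h
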